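/- Assume (H1), (H2), (H3), (H4), and (H5). Define L and H as in the mean field game model. Then the function J : Γ × Γ → [0,+∞] given by J(γ,γ̃) = L(γ) + L(γ̃) + H(γ,γ̃) is lower semicontinuous on Γ × Γ, and H is Borel measurable on Γ × Γ. -/

import Mathlib

open MeasureTheory Filter Topology Set
open scoped ENNReal NNReal

noncomputable section

/-- Euclidean space `ℝ^d`. -/
abbrev EucSp (d : ℕ) := EuclideanSpace ℝ (Fin d)

/-- The space `Γ = C(ℝ₊, Ω̄)` of continuous curves with values in `closure Ω`, endowed with
the topology of uniform convergence on compact time intervals (the compact-open topology). -/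
abbrev CurveSp {d : ℕ} (Ω : Set (EucSp d)) :=
  {γ : C(ℝ≥0, EucSp d) // ∀ t : ℝ≥0, γ t ∈ closure Ω}

variable {d : ℕ}

/-- `γ` is absolutely continuous with (locally integrable) velocity `g`. -/
def HasVel {Ω : Set (EucSp d)} (γ : CurveSp Ω) (g : ℝ → EucSp d) : Prop :=
  (∀ T : ℝ, IntegrableOn g (Set.Icc 0 T) volume) ∧
    ∀ t : ℝ≥0, γ.1 t = γ.1 0 + ∫ s in Set.Ioc (0 : ℝ) (t : ℝ), g s

/-- The first exit time `τ(γ) = inf {t ≥ 0 | γ(t) ∈ Ξ}`, with value `+∞` if `γ` never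
reaches `Ξ`. -/
def exitT {Ω : Set (EucSp d)} (Ξ : Set (EucSp d)) (γ : CurveSp Ω) : ℝ≥0∞ :=
  ⨅ (t : ℝ≥0) (_ : γ.1 t ∈ Ξ), (t : ℝ≥0∞)

/-- The extension of a nondecreasing `Ψ : ℝ₊ → ℝ₊` to `[0,+∞]`: for finite `T` it coincides
with `Ψ(T)` (as `Ψ` is nondecreasing), and `Ψ(+∞) = sup Ψ`. -/
def PsiExt (Ψ : ℝ → ℝ) (T : ℝ≥0∞) : ℝ≥0∞ :=
  ⨆ (t : ℝ≥0) (_ : (t : ℝ≥0∞) ≤ T), ENNReal.ofReal (Ψ (t : ℝ))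

/-- The individual cost `L(γ) = ∫₀^∞ ℓ(t,γ(t),γ̇(t)) dt + Ψ(τ(γ))` if `γ` is absolutely
continuous, and `L(γ) = +∞` otherwise (the infimum over an empty family is `+∞`; any two
velocities of `γ` agree a.e., so the infimum is the common value of the integral). -/
def Lcost {Ω : Set (EucSp d)} (ℓ : ℝ → EucSp d → EucSp d → ℝ) (Ψ : ℝ → ℝ)
    (Ξ : Set (EucSp d)) (γ : CurveSp Ω) : ℝ≥0∞ :=
  (⨅ (g : ℝ → EucSp d) (_ : HasVel γ g),
    ∫⁻ t in Set.Ioi (0 : ℝ), ENNReal.ofReal (ℓ t (γ.1 t.toNNReal) (g t))) +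
  PsiExt Ψ (exitT Ξ γ)

/-- The raw pairwise interaction cost
`∫₀^{τ(γ) ∧ τ(γ̃)} h(t,γ(t),γ̃(t),γ̇(t),γ̃̇(t)) dt`, equal to `+∞` when one of the curves is
not absolutely continuous. -/
def interCost {Ω : Set (EucSp d)}
    (h : ℝ → EucSp d → EucSp d → EucSp d → EucSp d → ℝ)
    (Ξ : Set (EucSp d)) (γ γ' : CurveSp Ω) : ℝ≥0∞ :=
  ⨅ (g : ℝ → EucSp d) (_ : HasVel γ g) (g' : ℝ → EucSp d) (_ : HasVel γ' g'),
    ∫⁻ t in {t : ℝ | 0 < t ∧ ENNReal.ofReal t < min (exitT Ξ γ) (exitT Ξ γ')},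
      ENNReal.ofReal (h t (γ.1 t.toNNReal) (γ'.1 t.toNNReal) (g t) (g' t))

/-- The interaction cost `H(γ,γ̃)`, equal to the raw interaction cost when
`L(γ) < +∞` and `L(γ̃) < +∞`, and to `+∞` otherwise. -/
def Hcost {Ω : Set (EucSp d)} (ℓ : ℝ → EucSp d → EucSp d → ℝ) (Ψ : ℝ → ℝ)
    (h : ℝ → EucSp d → EucSp d → EucSp d → EucSp d → ℝ)
    (Ξ : Set (EucSp d)) (γ γ' : CurveSp Ω) : ℝ≥0∞ :=
  if Lcost ℓ Ψ Ξ γ ≠ ⊤ ∧ Lcost ℓ Ψ Ξ γ' ≠ ⊤ then interCost h Ξ γ γ' else ⊤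

instance {Ω : Set (EucSp d)} : MeasurableSpace (CurveSp Ω) := borel _
instance {Ω : Set (EucSp d)} : BorelSpace (CurveSp Ω) := ⟨rfl⟩

/-- The total cost `F(γ,Q)` from the mean field game, with the conventions of the paper:
`F(γ,Q) = +∞` if `γ` is not absolutely continuous, if `Q` gives positive measure to
non-absolutely-continuous curves, or if the inner interaction integral is not `Q`-integrable. -/
def F1cost {Ω : Set (EucSp d)} (ℓ : ℝ → EucSp d → EucSp d → ℝ) (Ψ : ℝ → ℝ)
    (h : ℝ → EucSp d → EucSp d → EucSp d → EucSp d → ℝ)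
    (Ξ : Set (EucSp d)) (γ : CurveSp Ω) (Q : Measure (CurveSp Ω)) : ℝ≥0∞ :=
  if Q {γ' : CurveSp Ω | ¬ ∃ g : ℝ → EucSp d, HasVel γ' g} = 0 then
    Lcost ℓ Ψ Ξ γ + ∫⁻ γ', interCost h Ξ γ γ' ∂Q
  else ⊤

/-- The total cost `F(γ,Q) = L(γ) + ∫ H(γ,·) dQ` of the associated abstract non-atomic game. -/
def F2cost {Ω : Set (EucSp d)} (ℓ : ℝ → EucSp d → EucSp d → ℝ) (Ψ : ℝ → ℝ)
    (h : ℝ → EucSp d → EucSp d → EucSp d → EucSp d → ℝ)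
    (Ξ : Set (EucSp d)) (γ : CurveSp Ω) (Q : Measure (CurveSp Ω)) : ℝ≥0∞ :=
  Lcost ℓ Ψ Ξ γ + ∫⁻ γ', Hcost ℓ Ψ h Ξ γ γ' ∂Q

/-- The geodesic (intrinsic) distance in `S`: the infimum of the lengths (total variations)
of continuous paths in `S` joining `x` to `y`. -/
def geoDist {d : ℕ} (S : Set (EucSp d)) (x y : EucSp d) : ℝ≥0∞ :=
  ⨅ (f : ℝ → EucSp d) (_ : ContinuousOn f (Set.Icc 0 1))
    (_ : ∀ t ∈ Set.Icc (0 : ℝ) 1, f t ∈ S) (_ : f 0 = x) (_ : f 1 = y),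
    eVariationOn f (Set.Icc 0 1)



lemma exists_forall_affine_le_rpow {α θ : ℝ} (hα : 0 < α) (hθ : 1 < θ) (A B : ℝ) :
    ∃ R : ℝ, ∀ r, R ≤ r → A * r + B ≤ α * r ^ θ := by
  have h1 : ∀ᶠ r : ℝ in atTop, (|A| + |B|) / α ≤ r ^ (θ - 1) :=
    (tendsto_rpow_atTop (sub_pos.2 hθ)).eventually_ge_atTop _
  obtain ⟨R, hR⟩ := eventually_atTop.1 (h1.and (eventually_ge_atTop 1))
  refine ⟨R, fun r hr => ?_⟩
  obtain ⟨h2, h3⟩ := hR r hr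
  have h4 : r ^ θ = r ^ (θ - 1) * r := by
    rw [← Real.rpow_add_one (by positivity)]; ring_nf
  rw [div_le_iff₀ hα] at h2
  rw [h4]
  have : (|A| + |B|) * r ≤ r ^ (θ - 1) * α * r := by gcongr
  have h5 : A * r ≤ |A| * r := by gcongr; exact le_abs_self A
  have h6 : B ≤ |B| * r := (le_abs_self B).trans (le_mul_of_one_le_right (abs_nonneg B) h3)
  linarith

section Core

variable {X E : Type*} [NormedAddCommGroup E] [NormedSpace ℝ E] [FiniteDimensional ℝ E]

/-- A superlinear convex integrand, jointly continuous in state and velocity, is bounded below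
near a given state by a single affine function of the velocity, up to an arbitrarily small
error; the slope can be chosen in a prescribed dense set. -/
lemma exists_affine_minorant_nhdsWithin [TopologicalSpace X] {K : Set X} {f : X → E → ℝ}
    (hc : ContinuousOn (fun q : X × E => f q.1 q.2) (K ×ˢ univ))
    {x₀ : X} (hx₀ : x₀ ∈ K) (hconv : ConvexOn ℝ univ (f x₀))
    {α θ : ℝ} (hα : 0 < α) (hθ : 1 < θ) (hlb : ∀ x ∈ K, ∀ p, α * ‖p‖ ^ θ ≤ f x p)
    {D : Set (E →L[ℝ] ℝ)} (hD : Dense D) (p₀ : E) {ε : ℝ} (hε : 0 < ε) :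
    ∃ ξ ∈ D, ∀ᶠ x in 𝓝[K] x₀, ∀ p, f x₀ p₀ + ξ (p - p₀) - ε ≤ f x p := by
  have hc₀ : Continuous (f x₀) := by
    rw [← continuousOn_univ]
    exact hc.comp (f := fun p : E => (x₀, p)) (by fun_prop) fun p _ => ⟨hx₀, mem_univ _⟩
  obtain ⟨l, c, hl, hlc⟩ := hconv.exists_affine_le_of_lt (𝕜 := ℝ) (mem_univ p₀)
    (show f x₀ p₀ - ε / 2 < f x₀ p₀ by linarith) isClosed_univ
    (hc₀.lowerSemicontinuous.lowerSemicontinuousOn _)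
  have hl' : ∀ p, l p + c ≤ f x₀ p := fun p => hl ⟨p, mem_univ p⟩
  simp only [RCLike.re_to_real] at hlc
  obtain ⟨R, hR⟩ := exists_forall_affine_le_rpow hα hθ (‖l‖ + 1)
    (f x₀ p₀ + (‖l‖ + 1) * ‖p₀‖)
  have key : ∀ᶠ z : X × (E →L[ℝ] ℝ) in 𝓝 (x₀, l), ∀ p ∈ Metric.closedBall (0 : E) R,
      z.1 ∈ K → f x₀ p₀ + z.2 (p - p₀) - ε ≤ f z.1 p := by
    refine (isCompact_closedBall (0 : E) R).eventually_forall_of_forall_eventually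
      fun p _ => ?_
    have h1 : Tendsto (fun z : (X × (E →L[ℝ] ℝ)) × E => f z.1.1 z.2)
        (𝓝[{z | z.1.1 ∈ K}] ((x₀, l), p)) (𝓝 (f x₀ p)) := by
      have := hc (x₀, p) ⟨hx₀, mem_univ _⟩
      refine this.tendsto.comp (f := fun z : (X × (E →L[ℝ] ℝ)) × E => (z.1.1, z.2))
        (tendsto_nhdsWithin_of_tendsto_nhds_of_eventually_within _ ?_ ?_)
      · exact ((by fun_prop : Continuous fun z : (X × (E →L[ℝ] ℝ)) × E =>
          (z.1.1, z.2)).tendsto _).mono_left nhdsWithin_le_nhds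
      · filter_upwards [self_mem_nhdsWithin] with z hz using ⟨hz, mem_univ _⟩
    have h2 : Tendsto (fun z : (X × (E →L[ℝ] ℝ)) × E => f x₀ p₀ + z.1.2 (z.2 - p₀) - ε)
        (𝓝[{z | z.1.1 ∈ K}] ((x₀, l), p)) (𝓝 (f x₀ p₀ + l (p - p₀) - ε)) :=
      ((by fun_prop : Continuous fun z : (X × (E →L[ℝ] ℝ)) × E =>
        f x₀ p₀ + z.1.2 (z.2 - p₀) - ε).tendsto _).mono_left nhdsWithin_le_nhds
    have h3 : f x₀ p₀ + l (p - p₀) - ε < f x₀ p := by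
      have := hl' p
      rw [map_sub]
      linarith
    filter_upwards [eventually_nhdsWithin_iff.1 (h2.eventually_lt h1 h3)] with z hz hzK
      using (hz hzK).le
  rw [nhds_prod_eq] at key
  obtain ⟨pa, hpa, pb, hpb, hab⟩ := eventually_prod_iff.1 key
  have hnear : ∀ᶠ ξ in 𝓝 l, pb ξ ∧ ‖ξ‖ ≤ ‖l‖ + 1 := by
    refine hpb.and ?_
    exact (continuous_norm.tendsto l).eventually_le_const (lt_add_one _)
  obtain ⟨ξ, hξ, hξD⟩ := hD.exists_mem_open isOpen_interior ⟨l, mem_interior_iff_mem_nhds.2 hnear⟩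
  obtain ⟨hξb, hξn⟩ := interior_subset hξD
  refine ⟨ξ, hξ, eventually_nhdsWithin_iff.2 ?_⟩
  filter_upwards [hpa] with x hx hxK p
  by_cases hp : ‖p‖ ≤ R
  · exact hab hx hξb p (by simpa using hp) hxK
  · have h1 := hR ‖p‖ (not_le.1 hp).le
    have h2 : ξ (p - p₀) ≤ (‖l‖ + 1) * (‖p‖ + ‖p₀‖) :=
      (le_abs_self _).trans ((ξ.le_opNorm _).trans (by gcongr; exact norm_sub_le _ _))
    have h3 := hlb x hxK p
    linarith

/-- Composition of a Carathéodory function with a measurable function is measurable. -/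
lemma aemeasurable_comp_of_caratheodory {T W : Type*} [MeasurableSpace T] {μ : Measure T}
    [TopologicalSpace W] [TopologicalSpace.MetrizableSpace W] [SecondCountableTopology W]
    [MeasurableSpace W] [BorelSpace W] {K : Set W} (hK : MeasurableSet K) {F : T → W → ℝ}
    (hF : ∀ w, Measurable fun t => F t w) (hc : ∀ᵐ t ∂μ, ContinuousOn (F t) K)
    {z : T → W} (hz : AEMeasurable z μ) (hzK : ∀ᵐ t ∂μ, z t ∈ K) :
    AEMeasurable (fun t => F t (z t)) μ := by
  rcases K.eq_empty_or_nonempty with rfl | hne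
  · have : μ = 0 := by simpa [ae_eq_bot] using hzK
    simp [this]
  obtain ⟨z', hz', hz'K, hzz'⟩ := hz.exists_ae_eq_range_subset hzK hne
  obtain ⟨N, hNsub, hN, hN0⟩ := exists_measurable_superset_of_null hc
  have hcN : ∀ t ∉ N, ContinuousOn (F t) K := fun t ht => by
    by_contra h
    exact ht (hNsub h)
  classical
  let u : K → T → ℝ := fun w t => if t ∈ N then 0 else F t w
  have hu : Measurable (Function.uncurry u) := by
    refine measurable_uncurry_of_continuous_of_measurable (fun t => ?_) fun w => ?_
    · by_cases ht : t ∈ N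
      · simpa [u, ht] using continuous_const
      · simp only [u, ht, if_false]
        exact continuousOn_iff_continuous_domRestrict.1 (hcN t ht)
    · exact Measurable.ite hN measurable_const (hF w)
  have hz'' : Measurable fun t => (⟨z' t, hz'K ⟨t, rfl⟩⟩ : K) := hz'.subtype_mk
  refine ⟨fun t => u ⟨z' t, hz'K ⟨t, rfl⟩⟩ t, hu.comp (hz''.prodMk measurable_id), ?_⟩
  filter_upwards [hzz', measure_eq_zero_iff_ae_notMem.1 hN0] with t ht htN
  simp [u, htN, ht]

end Core

section LowerSemicontinuity

lemma ofReal_integral_le_lintegral_ofReal {T : Type*} [MeasurableSpace T] {μ : Measure T}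
    {f : T → ℝ} (hf : Integrable f μ) :
    ENNReal.ofReal (∫ t, f t ∂μ) ≤ ∫⁻ t, ENNReal.ofReal (f t) ∂μ := by
  calc ENNReal.ofReal (∫ t, f t ∂μ) ≤ ENNReal.ofReal (∫ t, max (f t) 0 ∂μ) :=
        ENNReal.ofReal_le_ofReal (integral_mono hf hf.pos_part fun t => le_max_left _ _)
    _ = ∫⁻ t, ENNReal.ofReal (max (f t) 0) ∂μ :=
        ofReal_integral_eq_lintegral_ofReal hf.pos_part
          (Eventually.of_forall fun t => le_max_right _ _)
    _ = ∫⁻ t, ENNReal.ofReal (f t) ∂μ := by simp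

variable {T X E : Type*} [MeasurableSpace T] [NormedAddCommGroup E] [NormedSpace ℝ E]
  [FiniteDimensional ℝ E]

lemma lintegral_le_liminf_of_affine_minorant {ν : Measure T} [IsFiniteMeasure ν]
    {φ : T → ℝ} (hφ : Integrable φ ν) (hφ0 : 0 ≤ᵐ[ν] φ) {f : ℕ → T → ℝ}
    {g : ℕ → T → E} {g₀ : T → E} (hg : ∀ n, Integrable (g n) ν) (hg₀ : Integrable g₀ ν)
    (hlim : Tendsto (fun n => ∫ t, g n t ∂ν) atTop (𝓝 (∫ t, g₀ t ∂ν)))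
    (ξ : E →L[ℝ] ℝ) {ε : ℝ} (hε : 0 ≤ ε)
    (hle : ∀ᶠ n in atTop, ∀ᵐ t ∂ν, φ t + ξ (g n t - g₀ t) - ε ≤ f n t) :
    ∫⁻ t, ENNReal.ofReal (φ t) ∂ν ≤
      liminf (fun n => ∫⁻ t, ENNReal.ofReal (f n t) ∂ν) atTop + ENNReal.ofReal ε * ν univ := by
  have hlin : ∀ n, Integrable (fun t => ξ (g n t - g₀ t)) ν := fun n =>
    ξ.integrable_comp ((hg n).sub hg₀)
  have h1 : Tendsto (fun n => ENNReal.ofReal (∫ t, (φ t + ξ (g n t - g₀ t) - ε) ∂ν)) atTop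
      (𝓝 (ENNReal.ofReal (∫ t, (φ t - ε) ∂ν))) := by
    refine ENNReal.tendsto_ofReal ?_
    have : ∀ n, ∫ t, (φ t + ξ (g n t - g₀ t) - ε) ∂ν =
        ∫ t, (φ t - ε) ∂ν + ξ ((∫ t, g n t ∂ν) - ∫ t, g₀ t ∂ν) := fun n => by
      have h := ξ.integral_comp_comm ((hg n).sub hg₀)
      simp only [Pi.sub_apply] at h
      have hφε : Integrable (fun t => φ t - ε) ν := hφ.sub (integrable_const ε)
      rw [← integral_sub (hg n) hg₀, ← h, ← integral_add hφε (hlin n)]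
      exact integral_congr_ae (Eventually.of_forall fun t => by simp; ring)
    simp_rw [this]
    have h2 : Tendsto (fun n => ξ ((∫ t, g n t ∂ν) - ∫ t, g₀ t ∂ν)) atTop (𝓝 0) := by
      have := (ξ.continuous.tendsto _).comp (hlim.sub_const (∫ t, g₀ t ∂ν))
      simpa [Function.comp_def] using this
    simpa using h2.const_add (∫ t, (φ t - ε) ∂ν)
  have h3 : ENNReal.ofReal (∫ t, (φ t - ε) ∂ν) ≤
      liminf (fun n => ∫⁻ t, ENNReal.ofReal (f n t) ∂ν) atTop := by
    rw [← h1.liminf_eq]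
    refine liminf_le_liminf ?_
    filter_upwards [hle] with n hn
    refine (ofReal_integral_le_lintegral_ofReal
      ((hφ.add (hlin n)).sub (integrable_const ε))).trans ?_
    exact lintegral_mono_ae (hn.mono fun t ht => ENNReal.ofReal_le_ofReal ht)
  calc ∫⁻ t, ENNReal.ofReal (φ t) ∂ν = ENNReal.ofReal (∫ t, φ t ∂ν) :=
        (ofReal_integral_eq_lintegral_ofReal hφ hφ0).symm
    _ = ENNReal.ofReal (∫ t, (φ t - ε) ∂ν + ε * (ν univ).toReal) := by
        rw [integral_sub hφ (integrable_const ε)]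
        simp [Measure.real, mul_comm]
    _ ≤ ENNReal.ofReal (∫ t, (φ t - ε) ∂ν) + ENNReal.ofReal (ε * (ν univ).toReal) :=
        ENNReal.ofReal_add_le
    _ ≤ _ := by
        rw [ENNReal.ofReal_mul hε, ENNReal.ofReal_toReal (measure_ne_top _ _)]
        gcongr

lemma tsum_liminf_le_liminf_tsum (u : ℕ → ℕ → ℝ≥0∞) :
    ∑' m, liminf (fun n => u n m) atTop ≤ liminf (fun n => ∑' m, u n m) atTop := by
  simp_rw [← lintegral_count]
  exact lintegral_liminf_le fun n => measurable_of_countable _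

/-- Lower semicontinuity of integral functionals with superlinear convex integrand, under uniform
convergence of the states and weak convergence of the velocities. -/
theorem lintegral_le_liminf_of_convex {μ : Measure T} [IsFiniteMeasure μ]
    [MetricSpace X] [SecondCountableTopology X] [MeasurableSpace X] [BorelSpace X]
    [MeasurableSpace E] [BorelSpace E]
    {K : Set X} (hK : MeasurableSet K) {F : T → X → E → ℝ}
    (hFm : ∀ x p, Measurable fun t => F t x p)
    (hFc : ∀ᵐ t ∂μ, ContinuousOn (fun q : X × E => F t q.1 q.2) (K ×ˢ univ))
    (hFconv : ∀ᵐ t ∂μ, ∀ x ∈ K, ConvexOn ℝ univ (F t x))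
    {α θ : ℝ} (hα : 0 < α) (hθ : 1 < θ)
    (hlb : ∀ᵐ t ∂μ, ∀ x ∈ K, ∀ p, α * ‖p‖ ^ θ ≤ F t x p)
    {x : ℕ → T → X} {x₀ : T → X} (hx₀ : Measurable x₀)
    (hxK : ∀ n, ∀ᵐ t ∂μ, x n t ∈ K) (hx₀K : ∀ᵐ t ∂μ, x₀ t ∈ K)
    (hx : ∀ δ > 0, ∀ᶠ n in atTop, ∀ᵐ t ∂μ, dist (x n t) (x₀ t) < δ)
    {g : ℕ → T → E} {g₀ : T → E} (hg : ∀ n, Integrable (g n) μ) (hg₀ : Integrable g₀ μ)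
    (hlim : ∀ B, MeasurableSet B →
      Tendsto (fun n => ∫ t in B, g n t ∂μ) atTop (𝓝 (∫ t in B, g₀ t ∂μ))) :
    ∫⁻ t, ENNReal.ofReal (F t (x₀ t) (g₀ t)) ∂μ ≤
      liminf (fun n => ∫⁻ t, ENNReal.ofReal (F t (x n t) (g n t)) ∂μ) atTop := by
  have : ProperSpace E := FiniteDimensional.proper_real E
  have : FiniteDimensional ℝ (E →L[ℝ] ℝ) := inferInstance
  have : ProperSpace (E →L[ℝ] ℝ) := FiniteDimensional.proper_real _
  refine ENNReal.le_of_forall_pos_le_add fun e he _ => ?_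
  obtain ⟨ε, hε, hεe⟩ : ∃ ε : ℝ, 0 < ε ∧ ENNReal.ofReal ε * μ univ ≤ e := by
    refine ⟨e / ((μ univ).toReal + 1), by positivity, ?_⟩
    rw [← ENNReal.ofReal_toReal (measure_ne_top μ univ), ← ENNReal.ofReal_mul (by positivity),
      ← ENNReal.ofReal_coe_nnreal]
    refine ENNReal.ofReal_le_ofReal ?_
    rw [div_mul_eq_mul_div, div_le_iff₀ (by positivity), ENNReal.toReal_ofReal (by positivity)]
    have : (0 : ℝ) ≤ e := e.2
    nlinarith
  have hφm : AEMeasurable (fun t => F t (x₀ t) (g₀ t)) μ :=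
    aemeasurable_comp_of_caratheodory (hK.prod MeasurableSet.univ)
      (F := fun t (q : X × E) => F t q.1 q.2) (fun w => hFm _ _) hFc
      (z := fun t => (x₀ t, g₀ t)) (hx₀.aemeasurable.prodMk hg₀.aemeasurable)
      (hx₀K.mono fun t ht => ⟨ht, mem_univ _⟩)
  obtain ⟨φ, hφ, hφeq⟩ := hφm
  obtain ⟨γ, hγ, hγeq⟩ := hg₀.aemeasurable
  obtain ⟨S, hSc, hSd⟩ := TopologicalSpace.exists_countable_dense (K × E)
  obtain ⟨σ, hσ⟩ := exists_surjective_nat (ℕ × ℕ × ℕ)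
  let ξ := TopologicalSpace.denseSeq (E →L[ℝ] ℝ)
  let A : ℕ × ℕ × ℕ → Set T := fun m => {t | φ t ≤ m.2.2 ∧ ∀ q ∈ S,
    dist (q.1 : X) (x₀ t) < 1 / (m.2.1 + 1) → φ t + ξ m.1 (q.2 - γ t) - ε ≤ F t q.1 q.2}
  have hA : ∀ m, MeasurableSet (A m) := fun m => by
    have hAm : A m = {t | φ t ≤ m.2.2} ∩ ⋂ q ∈ S,
        ({t | dist (q.1 : X) (x₀ t) < 1 / (m.2.1 + 1)}ᶜ ∪
          {t | φ t + ξ m.1 (q.2 - γ t) - ε ≤ F t q.1 q.2}) := by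
      ext t
      simp [A, imp_iff_not_or]
    rw [hAm]
    refine (measurableSet_le hφ measurable_const).inter
      (MeasurableSet.biInter hSc fun q _ => ?_)
    refine (measurableSet_lt (measurable_const.dist hx₀) measurable_const).compl.union ?_
    refine measurableSet_le ?_ (hFm _ _)
    exact (hφ.add ((ξ m.1).measurable.comp (measurable_const.sub hγ))).sub measurable_const
  have hA_imp : ∀ m, ∀ᵐ t ∂μ, t ∈ A m → ∀ y ∈ K, dist y (x₀ t) < 1 / (m.2.1 + 1) →
      ∀ p, φ t + ξ m.1 (p - γ t) - ε ≤ F t y p := fun m => by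
    filter_upwards [hFc] with t hct htA y hy hyd p
    let U : Set (K × E) := {q | dist (q.1 : X) (x₀ t) < 1 / (m.2.1 + 1)}
    have hU : IsOpen U := isOpen_lt (by fun_prop) continuous_const
    have hcl : IsClosed {q : K × E | φ t + ξ m.1 (q.2 - γ t) - ε ≤ F t q.1 q.2} := by
      refine isClosed_le (by fun_prop) ?_
      exact hct.comp_continuous (f := fun q : K × E => ((q.1 : X), q.2)) (by fun_prop)
        fun q => ⟨q.1.2, mem_univ _⟩
    have hsub : U ∩ S ⊆ {q : K × E | φ t + ξ m.1 (q.2 - γ t) - ε ≤ F t q.1 q.2} :=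
      fun q hq => htA.2 q hq.2 hq.1
    exact hcl.closure_subset_iff.2 hsub (hSd.open_subset_closure_inter hU
      (show ((⟨y, hy⟩, p) : K × E) ∈ U from hyd))
  have hA_cover : ∀ᵐ t ∂μ, t ∈ ⋃ i, A (σ i) := by
    filter_upwards [hFc, hFconv, hlb, hx₀K, hφeq, hγeq] with t hct hcv hlbt hxt hφt hγt
    obtain ⟨_, ⟨j, rfl⟩, hj⟩ := exists_affine_minorant_nhdsWithin hct hxt (hcv _ hxt) hα hθ hlbt
      (TopologicalSpace.denseRange_denseSeq (E →L[ℝ] ℝ)) (g₀ t) hε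
    obtain ⟨δ, hδ, hball⟩ := Metric.mem_nhdsWithin_iff.1 hj
    obtain ⟨k, hk⟩ := exists_nat_one_div_lt hδ
    obtain ⟨M, hM⟩ := exists_nat_ge (φ t)
    obtain ⟨i, hi⟩ := hσ (j, k, M)
    refine mem_iUnion.2 ⟨i, ?_⟩
    rw [hi]
    refine ⟨hM, fun q _ hq => ?_⟩
    rw [← hφt, ← hγt]
    exact hball ⟨hq.trans hk, q.1.2⟩ q.2
  let B := disjointed fun i => A (σ i)
  have hB : ∀ i, MeasurableSet (B i) := MeasurableSet.disjointed fun i => hA _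
  have hBA : ∀ i, B i ⊆ A (σ i) := disjointed_subset _
  have hBU : ⋃ i, B i = ⋃ i, A (σ i) := iUnion_disjointed
  have hsplit : ∀ f : T → ℝ≥0∞, ∫⁻ t, f t ∂μ = ∑' i, ∫⁻ t in B i, f t ∂μ := fun f => by
    rw [← lintegral_iUnion hB (disjoint_disjointed _), hBU,
      Measure.restrict_eq_self_of_ae_mem hA_cover]
  have hpiece : ∀ i, ∫⁻ t in B i, ENNReal.ofReal (φ t) ∂μ ≤
      liminf (fun n => ∫⁻ t in B i, ENNReal.ofReal (F t (x n t) (g n t)) ∂μ) atTop +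
        ENNReal.ofReal ε * μ (B i) := fun i => by
    have hφ0 : 0 ≤ᵐ[μ.restrict (B i)] φ := by
      filter_upwards [ae_restrict_of_ae hlb, ae_restrict_of_ae hx₀K, ae_restrict_of_ae hφeq]
        with t h1 h2 h3
      rw [← h3]
      exact le_trans (by positivity) (h1 _ h2 _)
    have hint : Integrable φ (μ.restrict (B i)) := by
      refine Integrable.of_bound hφ.aestronglyMeasurable ((σ i).2.2 : ℝ) ?_
      filter_upwards [hφ0, ae_restrict_mem (hB i)] with t h0 ht
      rw [Real.norm_of_nonneg h0]
      exact (hBA i ht).1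
    have := lintegral_le_liminf_of_affine_minorant (f := fun n t => F t (x n t) (g n t))
      hint hφ0 (fun n => (hg n).restrict)
      hg₀.restrict (hlim _ (hB i)) (ξ (σ i).1) hε.le ?_
    · simpa using this
    filter_upwards [hx (1 / ((σ i).2.1 + 1)) (by positivity)] with n hn
    filter_upwards [ae_restrict_of_ae hn, ae_restrict_of_ae (hA_imp (σ i)),
      ae_restrict_of_ae (hxK n), ae_restrict_of_ae hγeq, ae_restrict_mem (hB i)]
      with t h1 h2 h3 h4 h5
    rw [h4]
    exact h2 (hBA i h5) _ h3 h1 _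
  calc ∫⁻ t, ENNReal.ofReal (F t (x₀ t) (g₀ t)) ∂μ = ∫⁻ t, ENNReal.ofReal (φ t) ∂μ :=
        lintegral_congr_ae (hφeq.mono fun t ht => by simp [ht])
    _ ≤ ∑' i, (liminf (fun n => ∫⁻ t in B i, ENNReal.ofReal (F t (x n t) (g n t)) ∂μ) atTop +
        ENNReal.ofReal ε * μ (B i)) := by
        rw [hsplit]
        exact ENNReal.tsum_le_tsum hpiece
    _ ≤ liminf (fun n => ∫⁻ t, ENNReal.ofReal (F t (x n t) (g n t)) ∂μ) atTop + e := by
        rw [ENNReal.tsum_add, ENNReal.tsum_mul_left,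
          ← measure_iUnion (disjoint_disjointed _) hB]
        refine add_le_add ?_ (le_trans (by gcongr; exact subset_univ _) hεe)
        simp_rw [hsplit]
        exact tsum_liminf_le_liminf_tsum _

end LowerSemicontinuity

section WeakConvergence

variable {T E : Type*} [MeasurableSpace T] [NormedAddCommGroup E]

/-- Uniform absolute continuity of the integrals of the norms of a sequence of functions. -/
def UnifAbsCont (μ : Measure T) (g : ℕ → T → E) : Prop :=
  ∀ ε : ℝ, 0 < ε → ∃ δ : ℝ≥0∞, 0 < δ ∧ ∀ n B, MeasurableSet B → μ B ≤ δ →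
    ∫ t in B, ‖g n t‖ ∂μ ≤ ε

lemma UnifAbsCont.of_superlinear_bound {μ : Measure T} {g : ℕ → T → E}
    (hg : ∀ n, Integrable (g n) μ) {α θ : ℝ} (hα : 0 < α) (hθ : 1 < θ) {f : ℕ → T → ℝ}
    (hf : ∀ n, ∀ᵐ t ∂μ, α * ‖g n t‖ ^ θ ≤ f n t) {c : ℝ≥0∞} (hc : c ≠ ∞)
    (hfc : ∀ n, ∫⁻ t, ENNReal.ofReal (f n t) ∂μ ≤ c) : UnifAbsCont μ g := by
  intro ε hε
  lift c to ℝ≥0 using hc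
  let η : ℝ := ε / (2 * (c + 1))
  have hη : 0 < η := by positivity
  obtain ⟨R₀, hR₀⟩ := exists_forall_affine_le_rpow hα hθ η⁻¹ 0
  let R : ℝ := max R₀ 1
  have hR : 0 < R := lt_max_of_lt_right one_pos
  have hpt : ∀ n, ∀ᵐ t ∂μ, ‖g n t‖ ≤ R + η * f n t := fun n => by
    filter_upwards [hf n] with t ht
    have h0 : 0 ≤ f n t := le_trans (by positivity) ht
    rcases le_total ‖g n t‖ R with h | h
    · nlinarith
    · have h1 := hR₀ ‖g n t‖ ((le_max_left _ _).trans h)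
      rw [add_zero, inv_mul_le_iff₀ hη] at h1
      have h2 := mul_le_mul_of_nonneg_left ht hη.le
      linarith
  refine ⟨ENNReal.ofReal (ε / (2 * R)), by simpa using by positivity, fun n B hB hμB => ?_⟩
  rw [← ENNReal.ofReal_le_ofReal_iff hε.le,
    ofReal_integral_eq_lintegral_ofReal (hg n).norm.restrict
      (Eventually.of_forall fun t => norm_nonneg _)]
  calc ∫⁻ t in B, ENNReal.ofReal ‖g n t‖ ∂μ
      ≤ ∫⁻ t in B, (ENNReal.ofReal R + ENNReal.ofReal η * ENNReal.ofReal (f n t)) ∂μ := by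
        refine lintegral_mono_ae (ae_restrict_of_ae ?_)
        filter_upwards [hpt n] with t ht
        rw [← ENNReal.ofReal_mul hη.le]
        exact (ENNReal.ofReal_le_ofReal ht).trans ENNReal.ofReal_add_le
    _ = ENNReal.ofReal R * μ B +
        ENNReal.ofReal η * ∫⁻ t in B, ENNReal.ofReal (f n t) ∂μ := by
        rw [lintegral_add_left measurable_const,
          lintegral_const_mul' _ _ ENNReal.ofReal_ne_top]
        simp
    _ ≤ ENNReal.ofReal R * ENNReal.ofReal (ε / (2 * R)) +
        ENNReal.ofReal η * ENNReal.ofReal c := by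
        gcongr
        rw [ENNReal.ofReal_coe_nnreal]
        exact (setLIntegral_le_lintegral _ _).trans (hfc n)
    _ ≤ ENNReal.ofReal ε := by
        rw [← ENNReal.ofReal_mul hR.le, ← ENNReal.ofReal_mul hη.le,
          ← ENNReal.ofReal_add (by positivity) (by positivity)]
        refine ENNReal.ofReal_le_ofReal ?_
        have h1 : R * (ε / (2 * R)) = ε / 2 := by field_simp
        have h2 : η * c ≤ ε / 2 := by
          have : η * (c + 1) = ε / 2 := by simp only [η]; field_simp
          nlinarith
        linarith

lemma tendsto_setIntegral_of_isPiSystem {T : Type*} [NormedSpace ℝ E] [CompleteSpace E]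
    {m : MeasurableSpace T} {μ : Measure T} [IsFiniteMeasure μ] {g : ℕ → T → E} {g₀ : T → E}
    (hg : ∀ n, Integrable (g n) μ) (hg₀ : Integrable g₀ μ) (hui : UnifAbsCont μ g)
    {S : Set (Set T)} (hgen : m = MeasurableSpace.generateFrom S) (hS : IsPiSystem S)
    (hconv : ∀ s ∈ S, Tendsto (fun n => ∫ t in s, g n t ∂μ) atTop (𝓝 (∫ t in s, g₀ t ∂μ)))
    (huniv : Tendsto (fun n => ∫ t, g n t ∂μ) atTop (𝓝 (∫ t, g₀ t ∂μ)))
    {B : Set T} (hB : MeasurableSet B) :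
    Tendsto (fun n => ∫ t in B, g n t ∂μ) atTop (𝓝 (∫ t in B, g₀ t ∂μ)) := by
  induction B, hB using MeasurableSpace.induction_on_inter hgen hS with
  | empty => simp
  | basic s hs => exact hconv s hs
  | compl s hs ih =>
    simp_rw [fun n => setIntegral_compl hs (hg n), setIntegral_compl hs hg₀]
    exact huniv.sub ih
  | iUnion f hd hf ih =>
    have hsplit : ∀ N, ∀ u : T → E, Integrable u μ → ∫ t in ⋃ i, f i, u t ∂μ =
        ∑ i ∈ Finset.range N, ∫ t in f i, u t ∂μ + ∫ t in ⋃ i ≥ N, f i, u t ∂μ := by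
      intro N u hu
      have hU : ⋃ i, f i = (⋃ i ∈ Finset.range N, f i) ∪ ⋃ i ≥ N, f i := by
        ext t
        simp only [mem_iUnion, mem_union, Finset.mem_range, exists_prop]
        grind
      rw [hU, setIntegral_union, integral_biUnion_finset _ (fun i _ => hf i)
        (fun i _ j _ hij => hd hij) (fun i _ => hu.integrableOn)]
      · simp only [Set.disjoint_iUnion_left, Set.disjoint_iUnion_right, Finset.mem_range]
        exact fun j hj i hi => hd (by grind)
      · exact MeasurableSet.iUnion fun i => MeasurableSet.iUnion fun _ => hf i
      · exact hu.integrableOn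
      · exact hu.integrableOn
    have htail : Tendsto (μ ∘ fun N => ⋃ i ≥ N, f i) atTop (𝓝 0) :=
      tendsto_measure_biUnion_Ici_zero_of_pairwise_disjoint
        (fun i => (hf i).nullMeasurableSet) hd
    rw [Metric.tendsto_nhds]
    intro ε hε
    obtain ⟨δ, hδ, hδB⟩ := hui (ε / 4) (by positivity)
    have h0 := hg₀.tendsto_setIntegral_nhds_zero htail
    obtain ⟨N, hN1, hN2⟩ := ((htail.eventually_le_const hδ).and
      ((tendsto_zero_iff_norm_tendsto_zero.1 h0).eventually_le_const
        (show (0 : ℝ) < ε / 4 by positivity))).exists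
    have hsum : Tendsto (fun n => ∑ i ∈ Finset.range N, ∫ t in f i, g n t ∂μ) atTop
        (𝓝 (∑ i ∈ Finset.range N, ∫ t in f i, g₀ t ∂μ)) :=
      tendsto_finsetSum _ fun i _ => ih i
    filter_upwards [Metric.tendsto_nhds.1 hsum (ε / 4) (by positivity)] with n hn
    rw [hsplit N _ (hg n), hsplit N _ hg₀]
    have h1 : ‖∫ t in ⋃ i ≥ N, f i, g n t ∂μ‖ ≤ ε / 4 :=
      (norm_integral_le_integral_norm _).trans
        (hδB n _ (MeasurableSet.iUnion fun i => MeasurableSet.iUnion fun _ => hf i) hN1)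
    refine (dist_add_add_le _ _ _ _).trans_lt ?_
    have h2 : dist (∫ t in ⋃ i ≥ N, f i, g n t ∂μ) (∫ t in ⋃ i ≥ N, f i, g₀ t ∂μ)
        ≤ ε / 4 + ε / 4 := (dist_le_norm_add_norm _ _).trans (add_le_add h1 hN2)
    linarith

/-- On a bounded interval, convergence of the primitives and uniform integrability imply
convergence of the integrals over all measurable sets. -/
lemma tendsto_setIntegral_of_tendsto_integral_Ioc [NormedSpace ℝ E] [CompleteSpace E] {b : ℝ}
    (hb : 0 ≤ b) {g : ℕ → ℝ → E} {g₀ : ℝ → E}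
    (hg : ∀ n, IntegrableOn (g n) (Ioc 0 b)) (hg₀ : IntegrableOn g₀ (Ioc 0 b))
    (hui : UnifAbsCont (volume.restrict (Ioc 0 b)) g)
    (hconv : ∀ t ∈ Icc 0 b,
      Tendsto (fun n => ∫ s in Ioc 0 t, g n s) atTop (𝓝 (∫ s in Ioc 0 t, g₀ s)))
    {B : Set ℝ} (hB : MeasurableSet B) :
    Tendsto (fun n => ∫ t in B, g n t ∂(volume.restrict (Ioc 0 b))) atTop
      (𝓝 (∫ t in B, g₀ t ∂(volume.restrict (Ioc 0 b)))) := by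
  refine tendsto_setIntegral_of_isPiSystem hg hg₀ hui
    (BorelSpace.measurable_eq.trans (borel_eq_generateFrom_Iic ℝ)) isPiSystem_Iic ?_
    (hconv b ⟨hb, le_rfl⟩) hB
  rintro _ ⟨a, rfl⟩
  rw [Measure.restrict_restrict measurableSet_Iic]
  have : Iic a ∩ Ioc 0 b = Ioc 0 (max 0 (min a b)) := by
    ext t
    simp only [mem_inter_iff, mem_Iic, mem_Ioc]
    grind
  rw [this]
  exact hconv _ ⟨le_max_left _ _, max_le hb (min_le_right _ _)⟩

/-- A pointwise limit of functions with uniformly integrable moduli of absolute continuity is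
absolutely continuous. -/
lemma absolutelyContinuousOnInterval_of_tendsto {b : ℝ} (hb : 0 ≤ b) {g : ℕ → ℝ → E}
    (hg : ∀ n, IntegrableOn (g n) (Ioc 0 b))
    (hui : UnifAbsCont (volume.restrict (Ioc 0 b)) g) {f : ℕ → ℝ → ℝ} {f₀ : ℝ → ℝ}
    (hf : ∀ t ∈ Icc 0 b, Tendsto (fun n => f n t) atTop (𝓝 (f₀ t)))
    (hfg : ∀ n, ∀ s ∈ Icc 0 b, ∀ t ∈ Icc 0 b, dist (f n s) (f n t) ≤ ∫ r in uIoc s t, ‖g n r‖) :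
    AbsolutelyContinuousOnInterval f₀ 0 b := by
  rw [absolutelyContinuousOnInterval_iff]
  intro ε hε
  obtain ⟨δ', hδ', hδB⟩ := hui (ε / 2) (by positivity)
  obtain ⟨δ, hδ, hδδ'⟩ := ENNReal.lt_iff_exists_nnreal_btwn.1 hδ'
  refine ⟨δ, by simpa using hδ, ?_⟩
  rintro ⟨N, I⟩ hI hIδ
  have hsub := AbsolutelyContinuousOnInterval.biUnion_uIoc_subset_of_mem_disjWithin hI
  rw [uIoc_of_le hb] at hsub
  simp only [AbsolutelyContinuousOnInterval.disjWithin, mem_ofPred_eq, uIcc_of_le hb] at hI hIδ ⊢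
  have hlim : Tendsto (fun n => ∑ i ∈ Finset.range N, dist (f n (I i).1) (f n (I i).2)) atTop
      (𝓝 (∑ i ∈ Finset.range N, dist (f₀ (I i).1) (f₀ (I i).2))) :=
    tendsto_finsetSum _ fun i hi => (hf _ (hI.1 i hi).1).dist (hf _ (hI.1 i hi).2)
  refine lt_of_le_of_lt (le_of_tendsto' hlim fun n => ?_) (half_lt_self hε)
  have hmeas : MeasurableSet (⋃ i ∈ Finset.range N, uIoc (I i).1 (I i).2) :=
    Finset.measurableSet_biUnion _ fun i _ => measurableSet_uIoc
  calc ∑ i ∈ Finset.range N, dist (f n (I i).1) (f n (I i).2)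
      ≤ ∑ i ∈ Finset.range N, ∫ r in uIoc (I i).1 (I i).2, ‖g n r‖ :=
        Finset.sum_le_sum fun i hi => hfg n _ (hI.1 i hi).1 _ (hI.1 i hi).2
    _ = ∫ r in ⋃ i ∈ Finset.range N, uIoc (I i).1 (I i).2, ‖g n r‖ := by
        refine (integral_biUnion_finset _ (fun i _ => measurableSet_uIoc) hI.2
          fun i hi => ((hg n).mono_set ?_).norm).symm
        exact (subset_biUnion_of_mem (u := fun i => uIoc (I i).1 (I i).2) hi).trans hsub
    _ = ∫ r in ⋃ i ∈ Finset.range N, uIoc (I i).1 (I i).2, ‖g n r‖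
          ∂(volume.restrict (Ioc 0 b)) := by
        rw [Measure.restrict_restrict hmeas, inter_eq_self_of_subset_left hsub]
    _ ≤ ε / 2 := by
        refine hδB n _ hmeas (le_trans (Measure.restrict_apply_le _ _) ?_)
        refine (measure_biUnion_finset_le _ _).trans (le_trans ?_ hδδ'.le)
        have : ∀ i, volume (uIoc (I i).1 (I i).2) = ENNReal.ofReal (dist (I i).1 (I i).2) :=
          fun i => by simp [uIoc, Real.dist_eq, max_sub_min_eq_abs']
        simp_rw [this]
        rw [← ENNReal.ofReal_sum_of_nonneg fun _ _ => dist_nonneg, ← ENNReal.ofReal_coe_nnreal]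
        exact ENNReal.ofReal_le_ofReal hIδ.le

end WeakConvergence

section Velocity

variable {Ω : Set (EucSp d)} {γ : CurveSp Ω} {g g' : ℝ → EucSp d}

lemma HasVel.integrableOn_Ioc (hg : HasVel γ g) (b : ℝ) : IntegrableOn g (Ioc 0 b) :=
  (hg.1 b).mono_set Ioc_subset_Icc_self

lemma HasVel.intervalIntegrable (hg : HasVel γ g) {s t : ℝ} (hs : 0 ≤ s) (ht : 0 ≤ t) :
    IntervalIntegrable g volume s t := by
  refine (intervalIntegrable_iff').2 ((hg.1 (max s t)).mono_set ?_)
  exact Icc_subset_Icc (le_min hs ht) le_rfl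

lemma HasVel.eq_add_integral (hg : HasVel γ g) {t : ℝ} (ht : 0 ≤ t) :
    γ.1 t.toNNReal = γ.1 0 + ∫ s in (0 : ℝ)..t, g s := by
  rw [hg.2, Real.coe_toNNReal t ht, intervalIntegral.integral_of_le ht]

lemma HasVel.dist_le (hg : HasVel γ g) {s t : ℝ} (hs : 0 ≤ s) (ht : 0 ≤ t) :
    dist (γ.1 s.toNNReal) (γ.1 t.toNNReal) ≤ ∫ r in uIoc s t, ‖g r‖ := by
  rw [hg.eq_add_integral hs, hg.eq_add_integral ht, dist_add_left, dist_comm, dist_eq_norm,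
    intervalIntegral.integral_interval_sub_left (hg.intervalIntegrable le_rfl ht)
      (hg.intervalIntegrable le_rfl hs)]
  exact intervalIntegral.norm_integral_le_integral_norm_uIoc

lemma HasVel.aestronglyMeasurable (hg : HasVel γ g) :
    AEStronglyMeasurable g (volume.restrict (Ioi 0)) := by
  have : Ioi (0 : ℝ) ⊆ ⋃ n : ℕ, Icc 0 (n : ℝ) := fun t ht => by
    obtain ⟨n, hn⟩ := exists_nat_ge t
    exact mem_iUnion.2 ⟨n, ht.le, hn⟩
  exact (AEStronglyMeasurable.iUnion fun n : ℕ => (hg.1 n).aestronglyMeasurable).mono_set this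

lemma HasVel.ae_eq (hg : HasVel γ g) (hg' : HasVel γ g') :
    g =ᵐ[volume.restrict (Ioi 0)] g' := by
  rw [Filter.EventuallyEq, ae_restrict_iff' measurableSet_Ioi]
  have key : ∀ n : ℕ, ∀ᵐ t : ℝ, t ∈ Ioo 0 (n : ℝ) → g t = g' t := fun n => by
    filter_upwards [(hg.intervalIntegrable le_rfl n.cast_nonneg).ae_hasDerivAt_integral,
      (hg'.intervalIntegrable le_rfl n.cast_nonneg).ae_hasDerivAt_integral] with t h h' ht
    rw [uIcc_of_le n.cast_nonneg] at h h'
    have h0 : (0 : ℝ) ∈ Icc 0 (n : ℝ) := ⟨le_rfl, n.cast_nonneg⟩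
    refine (h ⟨ht.1.le, ht.2.le⟩ 0 h0).unique
      ((h' ⟨ht.1.le, ht.2.le⟩ 0 h0).congr_of_eventuallyEq ?_)
    filter_upwards [lt_mem_nhds ht.1] with s hs
    exact add_left_cancel ((hg.eq_add_integral hs.le).symm.trans (hg'.eq_add_integral hs.le))
  filter_upwards [ae_all_iff.2 key] with t ht ht0
  obtain ⟨n, hn⟩ := exists_nat_gt t
  exact ht n ⟨ht0, hn⟩

lemma HasVel.Lcost_eq (hg : HasVel γ g) (ℓ : ℝ → EucSp d → EucSp d → ℝ) (Ψ : ℝ → ℝ)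
    (Ξ : Set (EucSp d)) :
    Lcost ℓ Ψ Ξ γ = (∫⁻ t in Ioi (0 : ℝ), ENNReal.ofReal (ℓ t (γ.1 t.toNNReal) (g t))) +
      PsiExt Ψ (exitT Ξ γ) := by
  unfold Lcost
  congr 1
  refine le_antisymm (iInf₂_le g hg) (le_iInf₂ fun g' hg' => le_of_eq ?_)
  refine lintegral_congr_ae ?_
  filter_upwards [hg.ae_eq hg'] with t ht
  rw [ht]

lemma HasVel.interCost_eq {γ' : CurveSp Ω} (hg : HasVel γ g) (hg' : HasVel γ' g')
    (h : ℝ → EucSp d → EucSp d → EucSp d → EucSp d → ℝ) (Ξ : Set (EucSp d)) :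
    interCost h Ξ γ γ' =
      ∫⁻ t in {t : ℝ | 0 < t ∧ ENNReal.ofReal t < min (exitT Ξ γ) (exitT Ξ γ')},
        ENNReal.ofReal (h t (γ.1 t.toNNReal) (γ'.1 t.toNNReal) (g t) (g' t)) := by
  unfold interCost
  refine le_antisymm ((iInf₂_le g hg).trans (iInf₂_le g' hg'))
    (le_iInf₂ fun u hu => le_iInf₂ fun u' hu' => le_of_eq ?_)
  refine lintegral_congr_ae ?_
  have hsub : {t : ℝ | 0 < t ∧ ENNReal.ofReal t < min (exitT Ξ γ) (exitT Ξ γ')} ⊆ Ioi 0 :=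
    fun t ht => ht.1
  filter_upwards [ae_restrict_of_ae_restrict_of_subset hsub (hg.ae_eq hu),
    ae_restrict_of_ae_restrict_of_subset hsub (hg'.ae_eq hu')] with t ht ht'
  rw [ht, ht']

lemma exists_hasVel_of_Lcost_ne_top {ℓ : ℝ → EucSp d → EucSp d → ℝ} {Ψ : ℝ → ℝ}
    {Ξ : Set (EucSp d)} (hL : Lcost ℓ Ψ Ξ γ ≠ ∞) : ∃ g, HasVel γ g := by
  by_contra! hno
  exact hL (by simp [Lcost, hno])

lemma exists_hasVel_of_tendsto {γs : ℕ → CurveSp Ω} {gs : ℕ → ℝ → EucSp d}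
    (hgs : ∀ n, HasVel (γs n) (gs n)) (hui : ∀ b, UnifAbsCont (volume.restrict (Ioc 0 b)) gs)
    (hlim : Tendsto γs atTop (𝓝 γ)) : ∃ g, HasVel γ g := by
  have hpt : ∀ (i : Fin d) (t : ℝ),
      Tendsto (fun n => (γs n).1 t.toNNReal i) atTop (𝓝 (γ.1 t.toNNReal i)) := fun i t => by
    have h1 : Continuous fun c : CurveSp Ω => c.1 t.toNNReal i := by fun_prop
    exact (h1.tendsto γ).comp hlim
  have hac : ∀ (i : Fin d) (b : ℝ), 0 ≤ b →
      AbsolutelyContinuousOnInterval (fun t : ℝ => γ.1 t.toNNReal i) 0 b := fun i b hb => by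
    refine absolutelyContinuousOnInterval_of_tendsto hb (fun n => (hgs n).integrableOn_Ioc b)
      (hui b) (f := fun n t => (γs n).1 t.toNNReal i) (fun t _ => hpt i t)
      fun n s hs t ht => ?_
    refine le_trans ?_ ((hgs n).dist_le hs.1 ht.1)
    rw [dist_eq_norm, dist_eq_norm, ← PiLp.sub_apply]
    exact PiLp.norm_apply_le _ i
  have hint : ∀ b, IntegrableOn (fun t => WithLp.toLp 2 fun i =>
      deriv (fun s : ℝ => γ.1 s.toNNReal i) t : ℝ → EucSp d) (Icc 0 b) := fun b => by
    rcases lt_or_ge b 0 with hb | hb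
    · simp [Icc_eq_empty_of_lt hb]
    · refine Integrable.of_eval_piLp fun i => ?_
      exact (intervalIntegrable_iff_integrableOn_Icc_of_le hb).1 (hac i b hb).intervalIntegrable_deriv
  refine ⟨_, hint, fun t => ?_⟩
  ext i
  rw [PiLp.add_apply, eval_integral_piLp, ← intervalIntegral.integral_of_le t.coe_nonneg]
  · have := (hac i t t.2).integral_deriv_eq_sub
    simp only [Real.toNNReal_coe, Real.toNNReal_zero] at this
    simp [this]
  · intro i
    exact ((hint t).mono_set Ioc_subset_Icc_self).eval_piLp i

end Velocity

section ExitTime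

variable {Ω Ξ : Set (EucSp d)}

lemma lowerSemicontinuous_exitT (hΞ : IsClosed Ξ) :
    LowerSemicontinuous (exitT Ξ : CurveSp Ω → ℝ≥0∞) := by
  intro γ s hs
  obtain ⟨r, hsr, hr⟩ := ENNReal.lt_iff_exists_nnreal_btwn.1 hs
  have hmaps : MapsTo γ.1 (Icc 0 r) Ξᶜ := fun t ht htΞ =>
    hr.not_ge ((iInf₂_le t htΞ).trans (by exact_mod_cast ht.2))
  filter_upwards [continuous_subtype_val.continuousAt.eventually
    (ContinuousMap.eventually_mapsTo isCompact_Icc hΞ.isOpen_compl hmaps)] with γ' hγ'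
  refine hsr.trans_le (le_iInf₂ fun t ht => ?_)
  by_contra! hlt
  exact hγ' ⟨zero_le, by exact_mod_cast hlt.le⟩ ht

lemma lowerSemicontinuous_PsiExt_exitT (hΞ : IsClosed Ξ) {Ψ : ℝ → ℝ}
    (hΨ : LowerSemicontinuousOn Ψ (Ici 0)) :
    LowerSemicontinuous fun γ : CurveSp Ω => PsiExt Ψ (exitT Ξ γ) := by
  intro γ c hc
  obtain ⟨t, ht, hct⟩ : ∃ t : ℝ≥0, (t : ℝ≥0∞) ≤ exitT Ξ γ ∧ c < ENNReal.ofReal (Ψ t) := by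
    simpa only [PsiExt, lt_iSup_iff, exists_prop] using hc
  rcases eq_zero_or_pos t with rfl | ht0
  · exact Eventually.of_forall fun γ' =>
      hct.trans_le (le_iSup₂ (f := fun (t : ℝ≥0) (_ : (t : ℝ≥0∞) ≤ exitT Ξ γ') =>
        ENNReal.ofReal (Ψ t)) 0 (by simp))
  · have ht0' : (0 : ℝ) < t := by exact_mod_cast ht0
    have hcΨ := (ENNReal.lt_ofReal_iff_toReal_lt hct.ne_top).1 hct
    have hev := hΨ t ht0'.le _ hcΨ
    rw [nhdsWithin_eq_nhds.2 (Ici_mem_nhds ht0')] at hev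
    obtain ⟨s, hcs, hs⟩ :=
      ((hev.filter_mono nhdsWithin_le_nhds).and (Ioo_mem_nhdsLT ht0')).exists
    lift s to ℝ≥0 using hs.1.le
    have hst : (s : ℝ≥0∞) < exitT Ξ γ := lt_of_lt_of_le (by exact_mod_cast hs.2) ht
    filter_upwards [lowerSemicontinuous_exitT hΞ γ s hst] with γ' hγ'
    exact ((ENNReal.lt_ofReal_iff_toReal_lt hct.ne_top).2 hcs).trans_le
      (le_iSup₂ (f := fun (t : ℝ≥0) (_ : (t : ℝ≥0∞) ≤ exitT Ξ γ') =>
        ENNReal.ofReal (Ψ t)) s hγ'.le)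

end ExitTime

section TruncatedCost

/-- The structural assumptions on the running cost of a single agent. -/
structure IsRunningCost (Ω : Set (EucSp d)) (ℓ : ℝ → EucSp d → EucSp d → ℝ) (α θ : ℝ) :
    Prop where
  measurable : ∀ x p, Measurable fun t : ℝ => ℓ t x p
  continuousOn : ∀ᵐ t ∂(volume.restrict (Ioi (0 : ℝ))),
    ContinuousOn (fun q : EucSp d × EucSp d => ℓ t q.1 q.2) (closure Ω ×ˢ univ)
  convexOn : ∀ᵐ t ∂(volume.restrict (Ioi (0 : ℝ))), ∀ x ∈ closure Ω,
    ConvexOn ℝ univ fun p => ℓ t x p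
  le : ∀ t ∈ Ici (0 : ℝ), ∀ x ∈ closure Ω, ∀ p, α * ‖p‖ ^ θ ≤ ℓ t x p

/-- The structural assumptions on the pairwise interaction cost. -/
structure IsInteractionCost (Ω : Set (EucSp d))
    (h : ℝ → EucSp d → EucSp d → EucSp d → EucSp d → ℝ) : Prop where
  measurable : ∀ x x' p p', Measurable fun t : ℝ => h t x x' p p'
  continuousOn : ∀ᵐ t ∂(volume.restrict (Ioi (0 : ℝ))),
    ContinuousOn (fun q : (EucSp d × EucSp d) × EucSp d × EucSp d => h t q.1.1 q.1.2 q.2.1 q.2.2)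
      ((closure Ω ×ˢ closure Ω) ×ˢ univ)
  convexOn : ∀ᵐ t ∂(volume.restrict (Ioi (0 : ℝ))), ∀ x ∈ closure Ω, ∀ x' ∈ closure Ω,
    ConvexOn ℝ univ fun q : EucSp d × EucSp d => h t x x' q.1 q.2
  nonneg : ∀ t ∈ Ici (0 : ℝ), ∀ x ∈ closure Ω, ∀ x' ∈ closure Ω, ∀ p p', 0 ≤ h t x x' p p'

/-- The joint running cost of a pair of agents which interact up to time `s`. -/
def pairCost (ℓ : ℝ → EucSp d → EucSp d → ℝ)
    (h : ℝ → EucSp d → EucSp d → EucSp d → EucSp d → ℝ) (s : ℝ≥0∞) (t : ℝ)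
    (x p : EucSp d × EucSp d) : ℝ :=
  ℓ t x.1 p.1 + ℓ t x.2 p.2 +
    {r : ℝ | ENNReal.ofReal r < s}.indicator (fun r => h r x.1 x.2 p.1 p.2) t

variable {Ω : Set (EucSp d)} {ℓ : ℝ → EucSp d → EucSp d → ℝ}
  {h : ℝ → EucSp d → EucSp d → EucSp d → EucSp d → ℝ} {α θ : ℝ}

lemma measurableSet_ofReal_lt (s : ℝ≥0∞) : MeasurableSet {r : ℝ | ENNReal.ofReal r < s} :=
  measurableSet_lt (by fun_prop) measurable_const

lemma measurable_pairCost (hℓ : IsRunningCost Ω ℓ α θ) (hh : IsInteractionCost Ω h) (s : ℝ≥0∞)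
    (x p : EucSp d × EucSp d) : Measurable fun t => pairCost ℓ h s t x p :=
  ((hℓ.measurable _ _).add (hℓ.measurable _ _)).add
    ((hh.measurable _ _ _ _).indicator (measurableSet_ofReal_lt s))

lemma continuousOn_pairCost (hℓ : IsRunningCost Ω ℓ α θ) (hh : IsInteractionCost Ω h)
    (s : ℝ≥0∞) : ∀ᵐ t ∂(volume.restrict (Ioi (0 : ℝ))),
      ContinuousOn (fun q : (EucSp d × EucSp d) × EucSp d × EucSp d => pairCost ℓ h s t q.1 q.2)
        ((closure Ω ×ˢ closure Ω) ×ˢ univ) := by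
  filter_upwards [hℓ.continuousOn, hh.continuousOn] with t h1 h2
  refine ContinuousOn.add (ContinuousOn.add ?_ ?_) ?_
  · exact h1.comp (f := fun q : (EucSp d × EucSp d) × EucSp d × EucSp d => (q.1.1, q.2.1))
      (by fun_prop) fun q hq => ⟨hq.1.1, mem_univ _⟩
  · exact h1.comp (f := fun q : (EucSp d × EucSp d) × EucSp d × EucSp d => (q.1.2, q.2.2))
      (by fun_prop) fun q hq => ⟨hq.1.2, mem_univ _⟩
  · by_cases hts : t ∈ {r : ℝ | ENNReal.ofReal r < s}
    · simpa only [indicator_of_mem hts] using h2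
    · simpa only [indicator_of_notMem hts] using continuousOn_const

lemma convexOn_pairCost (hℓ : IsRunningCost Ω ℓ α θ) (hh : IsInteractionCost Ω h)
    (s : ℝ≥0∞) : ∀ᵐ t ∂(volume.restrict (Ioi (0 : ℝ))), ∀ x ∈ closure Ω ×ˢ closure Ω,
      ConvexOn ℝ univ (pairCost ℓ h s t x) := by
  filter_upwards [hℓ.convexOn, hh.convexOn] with t h1 h2 x hx
  refine ConvexOn.add (ConvexOn.add ?_ ?_) ?_
  · exact (h1 x.1 hx.1).comp_linearMap (LinearMap.fst ℝ (EucSp d) (EucSp d))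
  · exact (h1 x.2 hx.2).comp_linearMap (LinearMap.snd ℝ (EucSp d) (EucSp d))
  · by_cases hts : t ∈ {r : ℝ | ENNReal.ofReal r < s}
    · simpa only [indicator_of_mem hts] using h2 x.1 hx.1 x.2 hx.2
    · simpa only [indicator_of_notMem hts] using convexOn_const 0 convex_univ

lemma le_pairCost (hα : 0 < α) (hℓ : IsRunningCost Ω ℓ α θ)
    (hh : IsInteractionCost Ω h) (s : ℝ≥0∞) {t : ℝ} (ht : 0 ≤ t) {x : EucSp d × EucSp d}
    (hx : x ∈ closure Ω ×ˢ closure Ω) (p : EucSp d × EucSp d) :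
    α * ‖p‖ ^ θ ≤ pairCost ℓ h s t x p := by
  have h1 := hℓ.le t ht x.1 hx.1 p.1
  have h2 := hℓ.le t ht x.2 hx.2 p.2
  have h3 : 0 ≤ {r : ℝ | ENNReal.ofReal r < s}.indicator
      (fun r => h r x.1 x.2 p.1 p.2) t :=
    indicator_apply_nonneg fun _ => hh.nonneg t ht x.1 hx.1 x.2 hx.2 p.1 p.2
  have h4 : 0 ≤ α * ‖p.1‖ ^ θ := by positivity
  have h5 : 0 ≤ α * ‖p.2‖ ^ θ := by positivity
  rw [Prod.norm_def]
  unfold pairCost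
  rcases max_choice ‖p.1‖ ‖p.2‖ with hm | hm <;> rw [hm] <;> linarith

variable {γ γ' : CurveSp Ω} {g g' : ℝ → EucSp d}

lemma measurable_curve (γ : CurveSp Ω) : Measurable fun t : ℝ => γ.1 t.toNNReal :=
  (γ.1.continuous.comp continuous_real_toNNReal).measurable

lemma aemeasurable_runningCost (hℓ : IsRunningCost Ω ℓ α θ) (hg : HasVel γ g) :
    AEMeasurable (fun t => ℓ t (γ.1 t.toNNReal) (g t)) (volume.restrict (Ioi 0)) :=
  aemeasurable_comp_of_caratheodory (F := fun t (q : EucSp d × EucSp d) => ℓ t q.1 q.2)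
    (isClosed_closure.measurableSet.prod MeasurableSet.univ) (fun q => hℓ.measurable q.1 q.2)
    hℓ.continuousOn
    ((measurable_curve γ).aemeasurable.prodMk hg.aestronglyMeasurable.aemeasurable)
    (Eventually.of_forall fun _ => ⟨γ.2 _, mem_univ _⟩)

lemma aemeasurable_pairCost (hℓ : IsRunningCost Ω ℓ α θ) (hh : IsInteractionCost Ω h)
    (hg : HasVel γ g) (hg' : HasVel γ' g') (s : ℝ≥0∞) :
    AEMeasurable (fun t => pairCost ℓ h s t (γ.1 t.toNNReal, γ'.1 t.toNNReal) (g t, g' t))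
      (volume.restrict (Ioi 0)) :=
  aemeasurable_comp_of_caratheodory
    (F := fun t (q : (EucSp d × EucSp d) × EucSp d × EucSp d) => pairCost ℓ h s t q.1 q.2)
    ((isClosed_closure.measurableSet.prod isClosed_closure.measurableSet).prod MeasurableSet.univ)
    (fun q => measurable_pairCost hℓ hh s q.1 q.2) (continuousOn_pairCost hℓ hh s)
    (((measurable_curve γ).prodMk (measurable_curve γ')).aemeasurable.prodMk
      (hg.aestronglyMeasurable.aemeasurable.prodMk hg'.aestronglyMeasurable.aemeasurable))
    (Eventually.of_forall fun _ => ⟨⟨γ.2 _, γ'.2 _⟩, mem_univ _⟩)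

lemma lintegral_pairCost (hα : 0 < α) (hℓ : IsRunningCost Ω ℓ α θ)
    (hh : IsInteractionCost Ω h) (hg : HasVel γ g) (hg' : HasVel γ' g') (s : ℝ≥0∞) :
    ∫⁻ t in Ioi (0 : ℝ), ENNReal.ofReal
        (pairCost ℓ h s t (γ.1 t.toNNReal, γ'.1 t.toNNReal) (g t, g' t)) =
      (∫⁻ t in Ioi (0 : ℝ), ENNReal.ofReal (ℓ t (γ.1 t.toNNReal) (g t))) +
      (∫⁻ t in Ioi (0 : ℝ), ENNReal.ofReal (ℓ t (γ'.1 t.toNNReal) (g' t))) +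
      ∫⁻ t in {t : ℝ | 0 < t ∧ ENNReal.ofReal t < s},
        ENNReal.ofReal (h t (γ.1 t.toNNReal) (γ'.1 t.toNNReal) (g t) (g' t)) := by
  have hset : {t : ℝ | 0 < t ∧ ENNReal.ofReal t < s} = {t | ENNReal.ofReal t < s} ∩ Ioi 0 := by
    ext t
    exact and_comm
  rw [hset, ← Measure.restrict_restrict (measurableSet_ofReal_lt s),
    ← lintegral_indicator (measurableSet_ofReal_lt s),
    ← lintegral_add_left' (aemeasurable_runningCost hℓ hg).ennreal_ofReal,
    ← lintegral_add_left' (f := fun t => ENNReal.ofReal (ℓ t (γ.1 t.toNNReal) (g t)) +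
      ENNReal.ofReal (ℓ t (γ'.1 t.toNNReal) (g' t)))
      ((aemeasurable_runningCost hℓ hg).ennreal_ofReal.add
      (aemeasurable_runningCost hℓ hg').ennreal_ofReal)]
  refine setLIntegral_congr_fun measurableSet_Ioi fun t ht => ?_
  have ht0 : (0 : ℝ) ≤ t := le_of_lt ht
  have h1 : 0 ≤ ℓ t (γ.1 t.toNNReal) (g t) :=
    le_trans (by positivity) (hℓ.le t ht0 _ (γ.2 _) (g t))
  have h2 : 0 ≤ ℓ t (γ'.1 t.toNNReal) (g' t) :=
    le_trans (by positivity) (hℓ.le t ht0 _ (γ'.2 _) (g' t))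
  have h3 := hh.nonneg t ht0 _ (γ.2 t.toNNReal) _ (γ'.2 t.toNNReal) (g t) (g' t)
  simp only [pairCost]
  by_cases hts : t ∈ {r : ℝ | ENNReal.ofReal r < s}
  · simp only [indicator_of_mem hts]
    rw [ENNReal.ofReal_add (add_nonneg h1 h2) h3, ENNReal.ofReal_add h1 h2]
  · simp only [indicator_of_notMem hts, add_zero]
    rw [ENNReal.ofReal_add h1 h2]

lemma pairCost_mono (hh : IsInteractionCost Ω h) {s s' : ℝ≥0∞} (hs : s ≤ s') {t : ℝ}
    (ht : 0 ≤ t) {x : EucSp d × EucSp d} (hx : x ∈ closure Ω ×ˢ closure Ω)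
    (p : EucSp d × EucSp d) : pairCost ℓ h s t x p ≤ pairCost ℓ h s' t x p := by
  unfold pairCost
  gcongr
  exact hh.nonneg t ht x.1 hx.1 x.2 hx.2 p.1 p.2

/-- Bounds on the joint cost over bounded time intervals and interaction horizons pass to the
limit. -/
lemma lintegral_pairCost_le_of_truncated (hℓ : IsRunningCost Ω ℓ α θ)
    (hh : IsInteractionCost Ω h) (hg : HasVel γ g) (hg' : HasVel γ' g') {m Z : ℝ≥0∞}
    (hZ : ∀ (k : ℕ) (s : ℝ≥0∞), s < m ∨ s = 0 → ∫⁻ t in Ioc (0 : ℝ) k, ENNReal.ofReal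
        (pairCost ℓ h s t (γ.1 t.toNNReal, γ'.1 t.toNNReal) (g t, g' t)) ≤ Z) :
    ∫⁻ t in Ioi (0 : ℝ), ENNReal.ofReal
        (pairCost ℓ h m t (γ.1 t.toNNReal, γ'.1 t.toNNReal) (g t, g' t)) ≤ Z := by
  obtain ⟨s, hsm, hs⟩ : ∃ s : ℕ → ℝ≥0∞, (∀ k, s k < m ∨ s k = 0) ∧ Tendsto s atTop (𝓝 m) := by
    rcases eq_or_ne m 0 with rfl | hm
    · exact ⟨0, fun k => Or.inr rfl, tendsto_const_nhds⟩
    · obtain ⟨s, -, hs, hlim⟩ := exists_seq_strictMono_tendsto' (pos_iff_ne_zero.2 hm)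
      exact ⟨s, fun k => Or.inl (hs k).2, hlim⟩
  let f : ℕ → ℝ → ℝ≥0∞ := fun k => (Ioc (0 : ℝ) k).indicator fun t => ENNReal.ofReal
    (pairCost ℓ h (s k) t (γ.1 t.toNNReal, γ'.1 t.toNNReal) (g t, g' t))
  calc ∫⁻ t in Ioi (0 : ℝ), ENNReal.ofReal
        (pairCost ℓ h m t (γ.1 t.toNNReal, γ'.1 t.toNNReal) (g t, g' t))
      = ∫⁻ t in Ioi (0 : ℝ), liminf (fun k => f k t) atTop := by
        refine setLIntegral_congr_fun measurableSet_Ioi fun t ht => ?_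
        refine (Tendsto.liminf_eq (tendsto_const_nhds.congr' ?_)).symm
        have hts : ∀ᶠ k in atTop, (ENNReal.ofReal t < s k ↔ ENNReal.ofReal t < m) := by
          by_cases htm : ENNReal.ofReal t < m
          · filter_upwards [hs.eventually_const_lt htm] with k hk using iff_of_true hk htm
          · refine Eventually.of_forall fun k => iff_of_false (fun hk => ?_) htm
            rcases hsm k with h0 | h0
            · exact htm (hk.trans h0)
            · simp [h0] at hk
        filter_upwards [hts, tendsto_natCast_atTop_atTop.eventually_ge_atTop t] with k hk htk
        have htk' : t ∈ Ioc (0 : ℝ) k := ⟨ht, htk⟩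
        simp only [f, indicator_of_mem htk', pairCost, indicator, mem_ofPred_eq, hk]
    _ ≤ liminf (fun k => ∫⁻ t in Ioi (0 : ℝ), f k t) atTop :=
        lintegral_liminf_le' fun k =>
          (aemeasurable_pairCost hℓ hh hg hg' (s k)).ennreal_ofReal.indicator measurableSet_Ioc
    _ ≤ Z := by
        refine liminf_le_of_le (by isBoundedDefault) fun b hb => ?_
        obtain ⟨k, hk⟩ := hb.exists
        refine hk.trans (le_trans ?_ (hZ k (s k) (hsm k)))
        simp only [f]
        rw [lintegral_indicator measurableSet_Ioc,
          Measure.restrict_restrict measurableSet_Ioc]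
        exact lintegral_mono_set inter_subset_left

end TruncatedCost

lemma ENNReal.liminf_add_liminf_le (u v : ℕ → ℝ≥0∞) :
    liminf u atTop + liminf v atTop ≤ liminf (fun n => u n + v n) atTop := by
  simp_rw [liminf_eq_iSup_iInf_of_nat]
  rw [ENNReal.iSup_add_iSup_of_monotone]
  · exact iSup_mono fun n => le_iInf₂ fun i hi =>
      add_le_add (iInf₂_le i hi) (iInf₂_le i hi)
  · exact fun m n hmn => biInf_mono fun i hi => hmn.trans hi
  · exact fun m n hmn => biInf_mono fun i hi => hmn.trans hi

lemma LowerSemicontinuous.le_liminf_comp {X : Type*} [TopologicalSpace X] {f : X → ℝ≥0∞}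
    (hf : LowerSemicontinuous f) {u : ℕ → X} {x : X} (hu : Tendsto u atTop (𝓝 x)) :
    f x ≤ liminf (fun n => f (u n)) atTop :=
  (hf.le_liminf x).trans (liminf_le_liminf_of_le hu)

instance {Ω : Set (EucSp d)} : SecondCountableTopology (CurveSp Ω) :=
  TopologicalSpace.Subtype.secondCountableTopology
    {γ : C(ℝ≥0, EucSp d) | ∀ t : ℝ≥0, γ t ∈ closure Ω}

section SequentialLimit

variable {Ω Ξ : Set (EucSp d)} {ℓ : ℝ → EucSp d → EucSp d → ℝ}
  {h : ℝ → EucSp d → EucSp d → EucSp d → EucSp d → ℝ} {α θ : ℝ} {Ψ : ℝ → ℝ}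
  {γs γs' : ℕ → CurveSp Ω} {γ γ' : CurveSp Ω} {gs gs' : ℕ → ℝ → EucSp d} {g g' : ℝ → EucSp d}

lemma eventually_forall_dist_lt_of_tendsto (hlim : Tendsto γs atTop (𝓝 γ)) (b : ℝ) {δ : ℝ}
    (hδ : 0 < δ) : ∀ᶠ n in atTop, ∀ t ≤ b,
      dist ((γs n).1 t.toNNReal) (γ.1 t.toNNReal) < δ := by
  have h1 : Tendsto (fun n => (γs n).1) atTop (𝓝 γ.1) :=
    (continuous_subtype_val.tendsto γ).comp hlim
  have h2 := ContinuousMap.tendsto_iff_forall_isCompact_tendstoUniformlyOn.1 h1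
    (Icc 0 b.toNNReal) isCompact_Icc
  filter_upwards [Metric.tendstoUniformlyOn_iff.1 h2 δ hδ] with n hn t ht
  rw [dist_comm]
  exact hn _ ⟨zero_le, Real.toNNReal_le_toNNReal ht⟩

lemma HasVel.unifAbsCont (hα : 0 < α) (hθ : 1 < θ) (hℓ : IsRunningCost Ω ℓ α θ)
    (hgs : ∀ n, HasVel (γs n) (gs n)) {c : ℝ≥0∞} (hc : c ≠ ∞)
    (hbound : ∀ n, ∫⁻ t in Ioi (0 : ℝ), ENNReal.ofReal (ℓ t ((γs n).1 t.toNNReal) (gs n t)) ≤ c)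
    (b : ℝ) : UnifAbsCont (volume.restrict (Ioc 0 b)) gs := by
  refine UnifAbsCont.of_superlinear_bound (fun n => (hgs n).integrableOn_Ioc b) hα hθ
    (f := fun n t => ℓ t ((γs n).1 t.toNNReal) (gs n t)) (fun n => ?_) hc
    fun n => (lintegral_mono_set Ioc_subset_Ioi_self).trans (hbound n)
  filter_upwards [ae_restrict_mem measurableSet_Ioc] with t ht
  exact hℓ.le t ht.1.le _ ((γs n).2 _) _

lemma HasVel.tendsto_setIntegral (hgs : ∀ n, HasVel (γs n) (gs n)) (hg : HasVel γ g)
    (hlim : Tendsto γs atTop (𝓝 γ)) {b : ℝ} (hb : 0 ≤ b)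
    (hui : UnifAbsCont (volume.restrict (Ioc 0 b)) gs) {B : Set ℝ} (hB : MeasurableSet B) :
    Tendsto (fun n => ∫ t in B, gs n t ∂(volume.restrict (Ioc 0 b))) atTop
      (𝓝 (∫ t in B, g t ∂(volume.restrict (Ioc 0 b)))) := by
  refine tendsto_setIntegral_of_tendsto_integral_Ioc hb (fun n => (hgs n).integrableOn_Ioc b)
    (hg.integrableOn_Ioc b) hui (fun t ht => ?_) hB
  have key : ∀ {c : CurveSp Ω} {u : ℝ → EucSp d}, HasVel c u →
      ∫ s in Ioc 0 t, u s = c.1 t.toNNReal - c.1 0 := fun {c u} hu => by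
    rw [hu.2, Real.coe_toNNReal t ht.1, add_sub_cancel_left]
  have hcont : Continuous fun c : CurveSp Ω => c.1 t.toNNReal - c.1 0 := by fun_prop
  simp_rw [key hg, fun n => key (hgs n)]
  exact (hcont.tendsto γ).comp hlim

lemma lintegral_Ioc_pairCost_le_liminf (hα : 0 < α) (hθ : 1 < θ) (hℓ : IsRunningCost Ω ℓ α θ)
    (hh : IsInteractionCost Ω h) (hgs : ∀ n, HasVel (γs n) (gs n))
    (hgs' : ∀ n, HasVel (γs' n) (gs' n)) (hg : HasVel γ g) (hg' : HasVel γ' g')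
    (hlim : Tendsto γs atTop (𝓝 γ)) (hlim' : Tendsto γs' atTop (𝓝 γ')) {b : ℝ} (hb : 0 ≤ b)
    (hui : UnifAbsCont (volume.restrict (Ioc 0 b)) gs)
    (hui' : UnifAbsCont (volume.restrict (Ioc 0 b)) gs') (s : ℝ≥0∞) :
    ∫⁻ t in Ioc 0 b, ENNReal.ofReal
        (pairCost ℓ h s t (γ.1 t.toNNReal, γ'.1 t.toNNReal) (g t, g' t)) ≤
      liminf (fun n => ∫⁻ t in Ioc 0 b, ENNReal.ofReal
        (pairCost ℓ h s t ((γs n).1 t.toNNReal, (γs' n).1 t.toNNReal) (gs n t, gs' n t)))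
        atTop := by
  have hsub : Ioc 0 b ⊆ Ioi (0 : ℝ) := Ioc_subset_Ioi_self
  refine lintegral_le_liminf_of_convex (K := closure Ω ×ˢ closure Ω)
    (x := fun n t => ((γs n).1 t.toNNReal, (γs' n).1 t.toNNReal))
    (x₀ := fun t => (γ.1 t.toNNReal, γ'.1 t.toNNReal))
    (g := fun n t => (gs n t, gs' n t)) (g₀ := fun t => (g t, g' t))
    (isClosed_closure.measurableSet.prod isClosed_closure.measurableSet)
    (measurable_pairCost hℓ hh s)
    (ae_restrict_of_ae_restrict_of_subset hsub (continuousOn_pairCost hℓ hh s))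
    (ae_restrict_of_ae_restrict_of_subset hsub (convexOn_pairCost hℓ hh s)) hα hθ ?_
    ((measurable_curve γ).prodMk (measurable_curve γ'))
    (fun n => Eventually.of_forall fun t => ⟨(γs n).2 _, (γs' n).2 _⟩)
    (Eventually.of_forall fun t => ⟨γ.2 _, γ'.2 _⟩) (fun δ hδ => ?_)
    (fun n => ((hgs n).integrableOn_Ioc b).prodMk ((hgs' n).integrableOn_Ioc b))
    ((hg.integrableOn_Ioc b).prodMk (hg'.integrableOn_Ioc b)) fun B hB => ?_
  · filter_upwards [ae_restrict_mem measurableSet_Ioc] with t ht x hx p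
    exact le_pairCost hα hℓ hh s ht.1.le hx p
  · filter_upwards [eventually_forall_dist_lt_of_tendsto hlim b hδ,
      eventually_forall_dist_lt_of_tendsto hlim' b hδ] with n hn hn'
    filter_upwards [ae_restrict_mem measurableSet_Ioc] with t ht
    exact max_lt (hn t ht.2) (hn' t ht.2)
  · have hpair : ∀ {u u' : ℝ → EucSp d}, IntegrableOn u (Ioc 0 b) → IntegrableOn u' (Ioc 0 b) →
        ∫ t in B, (u t, u' t) ∂(volume.restrict (Ioc 0 b)) =
          (∫ t in B, u t ∂(volume.restrict (Ioc 0 b)),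
            ∫ t in B, u' t ∂(volume.restrict (Ioc 0 b))) := fun hu hu' =>
      integral_pair (Integrable.restrict hu) (Integrable.restrict hu')
    simp_rw [hpair (hg.integrableOn_Ioc b) (hg'.integrableOn_Ioc b),
      fun n => hpair ((hgs n).integrableOn_Ioc b) ((hgs' n).integrableOn_Ioc b)]
    exact (HasVel.tendsto_setIntegral hgs hg hlim hb hui hB).prodMk_nhds
      (HasVel.tendsto_setIntegral hgs' hg' hlim' hb hui' hB)

/-- The joint cost of a pair of curves in terms of their velocities. -/
lemma HasVel.totalCost_eq (hα : 0 < α) (hℓ : IsRunningCost Ω ℓ α θ)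
    (hh : IsInteractionCost Ω h) (hg : HasVel γ g) (hg' : HasVel γ' g') :
    Lcost ℓ Ψ Ξ γ + Lcost ℓ Ψ Ξ γ' + interCost h Ξ γ γ' =
      (∫⁻ t in Ioi (0 : ℝ), ENNReal.ofReal (pairCost ℓ h (min (exitT Ξ γ) (exitT Ξ γ')) t
        (γ.1 t.toNNReal, γ'.1 t.toNNReal) (g t, g' t))) +
      (PsiExt Ψ (exitT Ξ γ) + PsiExt Ψ (exitT Ξ γ')) := by
  rw [hg.Lcost_eq, hg'.Lcost_eq, hg.interCost_eq hg', lintegral_pairCost hα hℓ hh hg hg']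
  ring

lemma totalCost_le_of_tendsto (hα : 0 < α) (hθ : 1 < θ) (hΞ : IsClosed Ξ)
    (hℓ : IsRunningCost Ω ℓ α θ) (hh : IsInteractionCost Ω h)
    (hΨ : LowerSemicontinuousOn Ψ (Ici 0)) (hlim : Tendsto γs atTop (𝓝 γ))
    (hlim' : Tendsto γs' atTop (𝓝 γ')) {y : ℝ≥0∞} (hy : y ≠ ∞)
    (hJ : ∀ n, Lcost ℓ Ψ Ξ (γs n) + Lcost ℓ Ψ Ξ (γs' n) + Hcost ℓ Ψ h Ξ (γs n) (γs' n) ≤ y) :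
    Lcost ℓ Ψ Ξ γ + Lcost ℓ Ψ Ξ γ' + Hcost ℓ Ψ h Ξ γ γ' ≤ y := by
  have hL : ∀ n, Lcost ℓ Ψ Ξ (γs n) ≤ y := fun n =>
    (le_self_add.trans le_self_add).trans (hJ n)
  have hL' : ∀ n, Lcost ℓ Ψ Ξ (γs' n) ≤ y := fun n =>
    (le_add_self.trans le_self_add).trans (hJ n)
  choose gs hgs using fun n => exists_hasVel_of_Lcost_ne_top ((hL n).trans_lt hy.lt_top).ne
  choose gs' hgs' using fun n => exists_hasVel_of_Lcost_ne_top ((hL' n).trans_lt hy.lt_top).ne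
  have hui := HasVel.unifAbsCont hα hθ hℓ hgs hy fun n =>
    le_self_add.trans ((hgs n).Lcost_eq ℓ Ψ Ξ ▸ hL n)
  have hui' := HasVel.unifAbsCont hα hθ hℓ hgs' hy fun n =>
    le_self_add.trans ((hgs' n).Lcost_eq ℓ Ψ Ξ ▸ hL' n)
  obtain ⟨g, hg⟩ := exists_hasVel_of_tendsto hgs hui hlim
  obtain ⟨g', hg'⟩ := exists_hasVel_of_tendsto hgs' hui' hlim'
  let A : ℕ → ℝ≥0∞ := fun n => ∫⁻ t in Ioi (0 : ℝ), ENNReal.ofReal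
    (pairCost ℓ h (min (exitT Ξ (γs n)) (exitT Ξ (γs' n))) t
      ((γs n).1 t.toNNReal, (γs' n).1 t.toNNReal) (gs n t, gs' n t))
  have hAy : ∀ n, A n + (PsiExt Ψ (exitT Ξ (γs n)) + PsiExt Ψ (exitT Ξ (γs' n))) ≤ y :=
    fun n => by
      rw [← (hgs n).totalCost_eq hα hℓ hh (hgs' n)]
      have := hJ n
      rwa [Hcost, if_pos ⟨((hL n).trans_lt hy.lt_top).ne, ((hL' n).trans_lt hy.lt_top).ne⟩] at this
  have hA : ∫⁻ t in Ioi (0 : ℝ), ENNReal.ofReal (pairCost ℓ h (min (exitT Ξ γ) (exitT Ξ γ')) t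
      (γ.1 t.toNNReal, γ'.1 t.toNNReal) (g t, g' t)) ≤ liminf A atTop := by
    refine lintegral_pairCost_le_of_truncated hℓ hh hg hg' fun k s hs => ?_
    refine (lintegral_Ioc_pairCost_le_liminf hα hθ hℓ hh hgs hgs' hg hg' hlim hlim'
      k.cast_nonneg (hui k) (hui' k) s).trans (liminf_le_liminf ?_)
    have hsle : ∀ᶠ n in atTop, s ≤ min (exitT Ξ (γs n)) (exitT Ξ (γs' n)) := by
      rcases hs with hs | rfl
      · filter_upwards [hlim.eventually (lowerSemicontinuous_exitT hΞ γ s (lt_min_iff.1 hs).1),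
          hlim'.eventually (lowerSemicontinuous_exitT hΞ γ' s (lt_min_iff.1 hs).2)] with n h1 h2
        exact le_min h1.le h2.le
      · exact Eventually.of_forall fun n => zero_le
    filter_upwards [hsle] with n hn
    refine (lintegral_mono_set Ioc_subset_Ioi_self).trans
      (setLIntegral_mono' measurableSet_Ioi fun t ht => ?_)
    exact ENNReal.ofReal_le_ofReal
      (pairCost_mono hh hn (le_of_lt ht) ⟨(γs n).2 _, (γs' n).2 _⟩ _)
  have hΨ1 := (lowerSemicontinuous_PsiExt_exitT hΞ hΨ).le_liminf_comp hlim
  have hΨ2 := (lowerSemicontinuous_PsiExt_exitT hΞ hΨ).le_liminf_comp hlim'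
  have htot : Lcost ℓ Ψ Ξ γ + Lcost ℓ Ψ Ξ γ' + interCost h Ξ γ γ' ≤ y := by
    rw [hg.totalCost_eq hα hℓ hh hg']
    calc _ ≤ liminf A atTop + (liminf (fun n => PsiExt Ψ (exitT Ξ (γs n))) atTop +
          liminf (fun n => PsiExt Ψ (exitT Ξ (γs' n))) atTop) := by gcongr
      _ ≤ liminf A atTop +
          liminf (fun n => PsiExt Ψ (exitT Ξ (γs n)) + PsiExt Ψ (exitT Ξ (γs' n))) atTop := by
        gcongr
        exact ENNReal.liminf_add_liminf_le _ _
      _ ≤ liminf (fun n => A n +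
          (PsiExt Ψ (exitT Ξ (γs n)) + PsiExt Ψ (exitT Ξ (γs' n)))) atTop :=
        ENNReal.liminf_add_liminf_le _ _
      _ ≤ y := liminf_le_of_le (by isBoundedDefault) fun b hb => by
        obtain ⟨n, hn⟩ := hb.exists
        exact hn.trans (hAy n)
  have hfin := (htot.trans_lt hy.lt_top).ne
  simp only [ne_eq, ENNReal.add_eq_top, not_or] at hfin
  rwa [Hcost, if_pos hfin.1]

lemma lowerSemicontinuous_totalCost (hα : 0 < α) (hθ : 1 < θ) (hΞ : IsClosed Ξ)
    (hℓ : IsRunningCost Ω ℓ α θ) (hh : IsInteractionCost Ω h)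
    (hΨ : LowerSemicontinuousOn Ψ (Ici 0)) :
    LowerSemicontinuous fun p : CurveSp Ω × CurveSp Ω =>
      Lcost ℓ Ψ Ξ p.1 + Lcost ℓ Ψ Ξ p.2 + Hcost ℓ Ψ h Ξ p.1 p.2 := by
  rintro ⟨γ, γ'⟩ y hy
  by_contra hno
  obtain ⟨p, hp, hpy⟩ := exists_seq_forall_of_frequently (not_eventually.1 hno)
  exact hy.not_ge (totalCost_le_of_tendsto hα hθ hΞ hℓ hh hΨ
    ((continuous_fst.tendsto _).comp hp) ((continuous_snd.tendsto _).comp hp) hy.ne_top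
    fun n => not_lt.1 (hpy n))

lemma measurable_Lcost (hα : 0 < α) (hθ : 1 < θ) (hΞ : IsClosed Ξ)
    (hℓ : IsRunningCost Ω ℓ α θ) (hΨ : LowerSemicontinuousOn Ψ (Ici 0)) :
    Measurable (Lcost ℓ Ψ Ξ : CurveSp Ω → ℝ≥0∞) := by
  have h0 : IsInteractionCost Ω (fun _ _ _ _ _ => 0) :=
    { measurable := fun _ _ _ _ => measurable_const
      continuousOn := Eventually.of_forall fun _ => continuousOn_const
      convexOn := Eventually.of_forall fun _ _ _ _ _ => convexOn_const 0 convex_univ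
      nonneg := fun _ _ _ _ _ _ _ _ => le_rfl }
  have hmeas := ((lowerSemicontinuous_totalCost hα hθ hΞ hℓ h0 hΨ).comp
    (continuous_id.prodMk continuous_id)).measurable
  convert hmeas.div_const 2 using 2 with c
  by_cases hc : Lcost ℓ Ψ Ξ c = ∞
  · simp [hc, ENNReal.top_div]
  · obtain ⟨u, hu⟩ := exists_hasVel_of_Lcost_ne_top hc
    have : Hcost ℓ Ψ (fun _ _ _ _ _ => 0) Ξ c c = 0 := by
      rw [Hcost, if_pos ⟨hc, hc⟩, hu.interCost_eq hu]
      simp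
    simp only [Function.comp_apply, id_eq, this, add_zero]
    rw [ENNReal.add_div, ENNReal.add_halves]

lemma measurable_Hcost (hα : 0 < α) (hθ : 1 < θ) (hΞ : IsClosed Ξ)
    (hℓ : IsRunningCost Ω ℓ α θ) (hh : IsInteractionCost Ω h)
    (hΨ : LowerSemicontinuousOn Ψ (Ici 0)) :
    Measurable fun p : CurveSp Ω × CurveSp Ω => Hcost ℓ Ψ h Ξ p.1 p.2 := by
  have hL := measurable_Lcost hα hθ hΞ hℓ hΨ
  have hL1 : Measurable fun p : CurveSp Ω × CurveSp Ω => Lcost ℓ Ψ Ξ p.1 :=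
    hL.comp measurable_fst
  have hL2 : Measurable fun p : CurveSp Ω × CurveSp Ω => Lcost ℓ Ψ Ξ p.2 :=
    hL.comp measurable_snd
  have hJ := (lowerSemicontinuous_totalCost hα hθ hΞ hℓ hh hΨ).measurable
  have hS : MeasurableSet
      {p : CurveSp Ω × CurveSp Ω | Lcost ℓ Ψ Ξ p.1 ≠ ∞ ∧ Lcost ℓ Ψ Ξ p.2 ≠ ∞} :=
    (hL1 (measurableSet_singleton ∞)).compl.inter (hL2 (measurableSet_singleton ∞)).compl
  have heq : (fun p : CurveSp Ω × CurveSp Ω => Hcost ℓ Ψ h Ξ p.1 p.2) = fun p =>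
      if Lcost ℓ Ψ Ξ p.1 ≠ ∞ ∧ Lcost ℓ Ψ Ξ p.2 ≠ ∞ then
        Lcost ℓ Ψ Ξ p.1 + Lcost ℓ Ψ Ξ p.2 + Hcost ℓ Ψ h Ξ p.1 p.2 -
          (Lcost ℓ Ψ Ξ p.1 + Lcost ℓ Ψ Ξ p.2) else ∞ := by
    funext p
    split_ifs with hp
    · rw [ENNReal.add_sub_cancel_left (ENNReal.add_ne_top.2 hp)]
    · exact if_neg hp
  rw [heq]
  exact Measurable.ite hS (hJ.sub (hL1.add hL2)) measurable_const

end SequentialLimit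

/-- Lemma `lemm:J-lsc`: under (H1)–(H5), `J(γ,γ̃) = L(γ) + L(γ̃) + H(γ,γ̃)` is lower semicontinuous on `Γ × Γ` and `H` is Borel measurable. -/
theorem Jcost_lsc_and_Hcost_measurable {d : ℕ}
    (Ω : Set (EucSp d)) (hΩne : Ω.Nonempty) (hΩop : IsOpen Ω)
    (hΩbd : Bornology.IsBounded Ω)
    (Ξ : Set (EucSp d)) (hΞne : Ξ.Nonempty) (hΞcl : IsClosed Ξ) (hΞsub : Ξ ⊆ closure Ω)
    (ℓ : ℝ → EucSp d → EucSp d → ℝ)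
    (hℓmeas : ∀ x p, Measurable fun t : ℝ => ℓ t x p)
    (hℓcont : ∀ᵐ t ∂(volume.restrict (Set.Ioi (0 : ℝ))),
      ContinuousOn (fun q : EucSp d × EucSp d => ℓ t q.1 q.2)
        ((closure Ω) ×ˢ (Set.univ : Set (EucSp d))))
    (hℓconv : ∀ᵐ t ∂(volume.restrict (Set.Ioi (0 : ℝ))), ∀ x ∈ closure Ω,
      ConvexOn ℝ Set.univ fun p => ℓ t x p)
    (hℓnn : ∀ t ∈ Set.Ici (0 : ℝ), ∀ x ∈ closure Ω, ∀ p, 0 ≤ ℓ t x p)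
    (α θ : ℝ) (hα : 0 < α) (hθ : 1 < θ)
    (hℓlb : ∀ t ∈ Set.Ici (0 : ℝ), ∀ x ∈ closure Ω, ∀ p, α * ‖p‖ ^ θ ≤ ℓ t x p)
    (h : ℝ → EucSp d → EucSp d → EucSp d → EucSp d → ℝ)
    (hhmeas : ∀ x x' p p', Measurable fun t : ℝ => h t x x' p p')
    (hhcont : ∀ᵐ t ∂(volume.restrict (Set.Ioi (0 : ℝ))),
      ContinuousOn
        (fun q : (EucSp d × EucSp d) × EucSp d × EucSp d => h t q.1.1 q.1.2 q.2.1 q.2.2)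
        (((closure Ω) ×ˢ (closure Ω)) ×ˢ (Set.univ : Set (EucSp d × EucSp d))))
    (hhconv : ∀ᵐ t ∂(volume.restrict (Set.Ioi (0 : ℝ))), ∀ x ∈ closure Ω, ∀ x' ∈ closure Ω,
      ConvexOn ℝ Set.univ fun q : EucSp d × EucSp d => h t x x' q.1 q.2)
    (hhsymm : ∀ t x x' p p', h t x x' p p' = h t x' x p' p)
    (hhnn : ∀ t ∈ Set.Ici (0 : ℝ), ∀ x ∈ closure Ω, ∀ x' ∈ closure Ω, ∀ p p',
      0 ≤ h t x x' p p')
    (C β : ℝ) (hC : 0 < C) (hβ : 0 < β) (hβθ : β ≤ θ)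
    (hhub : ∀ t ∈ Set.Ici (0 : ℝ), ∀ x ∈ closure Ω, ∀ x' ∈ closure Ω, ∀ p p',
      h t x x' p p' ≤ C * (‖p‖ ^ β + ‖p'‖ ^ β))
    (Ψ : ℝ → ℝ) (hΨnn : ∀ t ∈ Set.Ici (0 : ℝ), 0 ≤ Ψ t)
    (hΨlsc : LowerSemicontinuousOn Ψ (Set.Ici 0)) (hΨmono : MonotoneOn Ψ (Set.Ici 0))
    (a b : ℝ) (ha : 0 < a) (hb : 0 < b)
    (hΨlb : ∀ t ∈ Set.Ici (0 : ℝ), a * t - b ≤ Ψ t) :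
    LowerSemicontinuous (fun p : CurveSp Ω × CurveSp Ω =>
      Lcost ℓ Ψ Ξ p.1 + Lcost ℓ Ψ Ξ p.2 + Hcost ℓ Ψ h Ξ p.1 p.2) ∧
    Measurable fun p : CurveSp Ω × CurveSp Ω => Hcost ℓ Ψ h Ξ p.1 p.2 := by
  have hℓ : IsRunningCost Ω ℓ α θ := ⟨hℓmeas, hℓcont, hℓconv, hℓlb⟩
  have hh : IsInteractionCost Ω h := ⟨hhmeas, hhcont, hhconv, hhnn⟩
  exact ⟨lowerSemicontinuous_totalCost hα hθ hΞcl hℓ hh hΨlsc,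
    measurable_Hcost hα hθ hΞcl hℓ hh hΨlsc⟩

end
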